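/- For every ε > 0 there exists A₁ ∈ ℕ such that for all real A > A₁, the open interval (A, A(1+ε)) contains at least one prime number. -/

import Mathlib

section

open MeasureTheory Filter Topology Complex FourierTransform
open scoped Real ArithmeticFunction LSeries.notation

/-- The restriction of `kernelFun` to `[0, π]`. -/
noncomputable def kernelProfile (t : ℝ) : ℝ :=
  3 / 4 * (π - t) * Real.cos t + 5 / 4 * Real.sin t

/-- An even function supported in `[-π, π]` whose Fourier transform at `w` is
`4 * (1 - v ^ 2 / 4) * (1 + cos (π * v)) / (1 - v ^ 2) ^ 2` with `v = 2 * π * w`, hence nonpositive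
for `1 ≤ |w|`. -/
noncomputable def kernelFun (t : ℝ) : ℝ := kernelProfile (min |t| π)

lemma kernelFun_continuous : Continuous kernelFun := by
  unfold kernelFun kernelProfile; fun_prop

lemma kernelFun_eq_zero {t : ℝ} (ht : π ≤ |t|) : kernelFun t = 0 := by
  simp [kernelFun, kernelProfile, min_eq_right ht]

lemma kernelFun_hasCompactSupport : HasCompactSupport kernelFun :=
  HasCompactSupport.intro (isCompact_Icc (a := -π) (b := π)) fun t ht ↦
    kernelFun_eq_zero (by
      by_contra! h
      exact ht ⟨(abs_lt.1 h).1.le, (abs_lt.1 h).2.le⟩)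

lemma integral_kernelProfile_mul_cos (v : ℝ) :
    (1 - v ^ 2) ^ 2 * ∫ t in (0)..π, Real.cos (v * t) * kernelProfile t =
      2 * (1 - v ^ 2 / 4) * (1 + Real.cos (π * v)) := by
  have hderiv (t : ℝ) : HasDerivAt (fun t ↦
      (1 - v ^ 2) ^ 2 * (1 / 4) * (-(π - t) * Real.sin t * Real.cos (v * t) +
        v * ((π - t) * Real.cos t + Real.sin t) * Real.sin (v * t)) -
      (1 - v ^ 2 / 4) * (1 - v ^ 2) * (-(π - t) * Real.sin t * Real.cos (v * t) +
        v * ((π - t) * Real.cos t + Real.sin t) * Real.sin (v * t)) -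
      2 * (1 - v ^ 2 / 4) * (Real.cos t * Real.cos (v * t) + v * Real.sin t * Real.sin (v * t)))
      ((1 - v ^ 2) ^ 2 * (Real.cos (v * t) * kernelProfile t)) t := by
    have hs := Real.hasDerivAt_sin t
    have hc := Real.hasDerivAt_cos t
    have hl : HasDerivAt (fun t ↦ v * t) v t := by simpa using (hasDerivAt_id t).const_mul v
    have hp : HasDerivAt (fun t ↦ π - t) (-1) t := by simpa using (hasDerivAt_id t).const_sub π
    have hsv := hl.sin
    have hcv := hl.cos
    have h1 := ((hp.neg.mul hs).mul hcv).add
      ((((hp.mul hc).add hs).const_mul v).mul hsv)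
    have h2 := ((hc.mul hcv).add ((hs.const_mul v).mul hsv)).const_mul (2 * (1 - v ^ 2 / 4))
    refine (((h1.const_mul ((1 - v ^ 2) ^ 2 * (1 / 4))).sub
      (h1.const_mul ((1 - v ^ 2 / 4) * (1 - v ^ 2)))).sub h2).congr_deriv ?_
    simp [kernelProfile]
    ring
  rw [← intervalIntegral.integral_const_mul,
    intervalIntegral.integral_eq_sub_of_hasDerivAt (fun t _ ↦ hderiv t)
      (Continuous.intervalIntegrable (by unfold kernelProfile; fun_prop) _ _)]
  simp [mul_comm v π]
  ring

lemma fourier_kernelFun (w : ℝ) :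
    𝓕 (fun t ↦ (kernelFun t : ℂ)) w =
      ((2 * ∫ t in (0)..π, Real.cos (2 * π * w * t) * kernelProfile t : ℝ) : ℂ) := by
  have h_int (g : ℝ → ℝ) (hg : Continuous g) : Integrable fun t ↦ g t * kernelFun t :=
    (hg.mul kernelFun_continuous).integrable_of_hasCompactSupport
      kernelFun_hasCompactSupport.mul_left
  have h_int' (g : ℝ → ℝ) (hg : Continuous g) :
      Integrable fun t ↦ ((g t * kernelFun t : ℝ) : ℂ) := (h_int g hg).ofReal
  have hodd : ∫ t, Real.sin (2 * π * w * t) * kernelFun t = 0 := by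
    have := integral_neg_eq_self (fun t ↦ Real.sin (2 * π * w * t) * kernelFun t) volume
    simp only [mul_neg, Real.sin_neg, kernelFun, abs_neg, neg_mul, integral_neg] at this ⊢
    linarith
  have heven : ∫ t, Real.cos (2 * π * w * t) * kernelFun t =
      2 * ∫ t in (0)..π, Real.cos (2 * π * w * t) * kernelProfile t := by
    have h1 := integral_comp_abs
      (f := fun t ↦ Real.cos (2 * π * w * t) * kernelProfile (min t π))
    have h2 (t : ℝ) : Real.cos (2 * π * w * |t|) = Real.cos (2 * π * w * t) := by
      rcases abs_choice t with h | h <;> simp [h]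
    simp only [h2] at h1
    rw [intervalIntegral.integral_of_le Real.pi_pos.le, show
      ∫ t, Real.cos (2 * π * w * t) * kernelFun t = _ from h1]
    congr 1
    refine (setIntegral_eq_of_subset_of_forall_sdiff_eq_zero measurableSet_Ioi
      Set.Ioc_subset_Ioi_self ?_).trans (setIntegral_congr_fun measurableSet_Ioc fun t ht ↦ ?_)
    · rintro t ⟨ht, ht'⟩
      have : π ≤ t := by
        by_contra! h
        exact ht' ⟨ht, h.le⟩
      simp [min_eq_right this, kernelProfile]
    · simp [min_eq_left ht.2]
  rw [Real.fourier_real_eq_integral_exp_smul, ← heven]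
  have hpt (t : ℝ) : cexp (↑(-2 * π * t * w) * I) • (kernelFun t : ℂ) =
      ((Real.cos (2 * π * w * t) * kernelFun t : ℝ) : ℂ) -
        ((Real.sin (2 * π * w * t) * kernelFun t : ℝ) : ℂ) * I := by
    rw [Complex.exp_mul_I, ← ofReal_cos, ← ofReal_sin,
      show -2 * π * t * w = -(2 * π * w * t) by ring, Real.cos_neg, Real.sin_neg]
    push_cast [smul_eq_mul]
    ring
  simp_rw [hpt]
  rw [integral_sub (h_int' (fun t ↦ Real.cos (2 * π * w * t)) (by fun_prop))
      ((h_int' (fun t ↦ Real.sin (2 * π * w * t)) (by fun_prop)).mul_const I),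
    integral_mul_const, integral_complex_ofReal, integral_complex_ofReal, hodd]
  simp

lemma sq_mul_fourier_kernelFun (w : ℝ) :
    (1 - (2 * π * w) ^ 2) ^ 2 * (𝓕 (fun t ↦ (kernelFun t : ℂ)) w).re =
      4 * (1 - (2 * π * w) ^ 2 / 4) * (1 + Real.cos (π * (2 * π * w))) := by
  rw [fourier_kernelFun, ofReal_re]
  linear_combination 2 * integral_kernelProfile_mul_cos (2 * π * w)

lemma fourier_kernelFun_bounds {w : ℝ} (hw : 1 ≤ |w|) :
    (𝓕 (fun t ↦ (kernelFun t : ℂ)) w).re ≤ 0 ∧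
      -(8 / w ^ 2) ≤ (𝓕 (fun t ↦ (kernelFun t : ℂ)) w).re := by
  have h := sq_mul_fourier_kernelFun w
  have hw2 : 1 ≤ w ^ 2 := by rwa [one_le_sq_iff_one_le_abs]
  have hv : 36 * w ^ 2 ≤ (2 * π * w) ^ 2 := by
    have : 36 ≤ (2 * π) ^ 2 := by nlinarith [Real.pi_gt_three]
    rw [mul_pow (2 * π)]
    gcongr
  generalize (𝓕 (fun t ↦ (kernelFun t : ℂ)) w).re = K at *
  generalize (2 * π * w) ^ 2 = u at *
  have hc := Real.neg_one_le_cos (π * (2 * π * w))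
  have hc' := Real.cos_le_one (π * (2 * π * w))
  generalize Real.cos (π * (2 * π * w)) = c at *
  have hK : K ≤ 0 := by
    by_contra! hK
    have : 0 < (1 - u) ^ 2 * K := by
      have : 1 - u ≠ 0 := by linarith
      positivity
    nlinarith
  refine ⟨hK, ?_⟩
  rw [neg_le, le_div_iff₀ (by positivity)]
  have h1 : (u / 2) ^ 2 * -K ≤ 2 * u := by
    have : (u / 2) ^ 2 ≤ (1 - u) ^ 2 := by nlinarith
    nlinarith
  have h2 : u * -K ≤ 8 := by
    by_contra! h3
    nlinarith
  nlinarith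

lemma integrable_fourier_kernelFun : Integrable (𝓕 (fun t ↦ (kernelFun t : ℂ))) := by
  have hφ : Integrable (fun t ↦ (kernelFun t : ℂ)) :=
    (kernelFun_continuous.integrable_of_hasCompactSupport kernelFun_hasCompactSupport).ofReal
  have hcont : Continuous (𝓕 (fun t ↦ (kernelFun t : ℂ))) :=
    VectorFourier.fourierIntegral_continuous Real.continuous_fourierChar
      (by fun_prop) hφ
  set M := ∫ t, ‖(kernelFun t : ℂ)‖
  have hM : 0 ≤ M := integral_nonneg fun _ ↦ norm_nonneg _
  refine (integrable_inv_one_add_sq.const_mul (2 * M + 16)).mono' hcont.aestronglyMeasurable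
    (.of_forall fun w ↦ ?_)
  rw [← div_eq_mul_inv, le_div_iff₀ (by positivity)]
  rcases le_total 1 |w| with hw | hw
  · obtain ⟨h1, h2⟩ := fourier_kernelFun_bounds hw
    have hw2 : 1 ≤ w ^ 2 := by rwa [one_le_sq_iff_one_le_abs]
    have h3 : ‖𝓕 (fun t ↦ (kernelFun t : ℂ)) w‖ = -(𝓕 (fun t ↦ (kernelFun t : ℂ)) w).re := by
      rw [fourier_kernelFun] at h1 ⊢
      rw [norm_real, ofReal_re, Real.norm_of_nonpos (by simpa using h1)]
    rw [neg_le, le_div_iff₀ (by positivity)] at h2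
    rw [h3]
    nlinarith
  · have hw2 : w ^ 2 ≤ 1 := by rwa [sq_le_one_iff_abs_le_one]
    have : ‖𝓕 (fun t ↦ (kernelFun t : ℂ)) w‖ ≤ M :=
      VectorFourier.norm_fourierIntegral_le_integral_norm _ _ _ _ _
    nlinarith [norm_nonneg (𝓕 (fun t ↦ (kernelFun t : ℂ)) w)]

lemma fourier_comp_mul_left (f : ℝ → ℂ) {a : ℝ} (ha : 0 < a) (w : ℝ) :
    𝓕 (fun t ↦ f (a * t)) w = a⁻¹ • 𝓕 f (a⁻¹ * w) := by
  have := Measure.integral_comp_mul_left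
    (fun t ↦ cexp (↑(-2 * π * t * (a⁻¹ * w)) * I) • f t) a
  rw [abs_of_pos (inv_pos.2 ha)] at this
  rw [Real.fourier_real_eq_integral_exp_smul, Real.fourier_real_eq_integral_exp_smul, ← this]
  congr! 6 with t
  field_simp

lemma exists_fourier_nonpos_of_le_abs {η : ℝ} (hη : 0 < η) :
    ∃ φ : ℝ → ℂ, Continuous φ ∧ HasCompactSupport φ ∧ Integrable (𝓕 φ) ∧ 0 < (φ 0).re ∧
      ∀ w, η ≤ |w| → (𝓕 φ w).re ≤ 0 := by
  have hF : 𝓕 (fun t ↦ (kernelFun (η * t) : ℂ)) =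
      fun w ↦ η⁻¹ • 𝓕 (fun t ↦ (kernelFun t : ℂ)) (η⁻¹ * w) :=
    funext (fourier_comp_mul_left (fun t ↦ (kernelFun t : ℂ)) hη)
  refine ⟨fun t ↦ (kernelFun (η * t) : ℂ), ?_, ?_, ?_, ?_, fun w hw ↦ ?_⟩
  · have := kernelFun_continuous
    fun_prop
  · exact (kernelFun_hasCompactSupport.comp_homeomorph
      (Homeomorph.mulLeft₀ η hη.ne')).comp_left (g := ((↑) : ℝ → ℂ)) ofReal_zero
  · rw [hF]
    exact (integrable_fourier_kernelFun.comp_mul_left' (inv_ne_zero hη.ne')).smul η⁻¹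
  · have := Real.pi_pos
    simp only [kernelFun, kernelProfile, mul_zero, abs_zero, min_eq_left this.le, ofReal_re]
    simp [this]
  · simp only [hF, real_smul, re_ofReal_mul]
    refine mul_nonpos_of_nonneg_of_nonpos (by positivity) (fourier_kernelFun_bounds ?_).1
    rwa [abs_mul, abs_of_pos (inv_pos.2 hη), inv_mul_eq_div, one_le_div hη]

lemma exists_continuousOn_LSeries_vonMangoldt_eq :
    ∃ G : ℂ → ℂ, ContinuousOn G {s | 1 ≤ s.re} ∧
      ∀ s : ℂ, 1 < s.re → LSeries ↗Λ s = G s + 1 / (s - 1) := by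
  refine ⟨ArithmeticFunction.vonMangoldt.LFunctionResidueClassAux (1 : ZMod 1),
    ArithmeticFunction.vonMangoldt.continuousOn_LFunctionResidueClassAux 1, fun s hs ↦ ?_⟩
  rw [ArithmeticFunction.vonMangoldt.eqOn_LFunctionResidueClassAux isUnit_one hs]
  have : ArithmeticFunction.vonMangoldt.residueClass (1 : ZMod 1) = fun n ↦ Λ n := by
    ext n
    exact Set.indicator_of_mem (s := {n : ℕ | (n : ZMod 1) = 1})
      (Subsingleton.elim (n : ZMod 1) 1) _
  simp [this]

variable {φ : ℝ → ℂ}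

lemma hasSum_vonMangoldt_mul_fourier (hφ : Integrable φ) {σ : ℝ} (hσ : 1 < σ) (y : ℝ) :
    HasSum (fun n : ℕ ↦ ((Λ n * (n : ℝ) ^ (-σ) : ℝ) : ℂ) * 𝓕 φ (Real.log n - y))
      (∫ t : ℝ, cexp (2 * π * t * y * I) * φ t * LSeries ↗Λ (σ + 2 * π * t * I)) := by
  have hterm (n : ℕ) (t : ℝ) : LSeries.term ↗Λ (σ + 2 * π * t * I) n =
      ((Λ n * (n : ℝ) ^ (-σ) : ℝ) : ℂ) * cexp (-(2 * π * t * Real.log n * I)) := by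
    rw [LSeries.term_def₀ (by simp)]
    rcases eq_or_ne n 0 with rfl | hn
    · simp
    · have hn' : (n : ℂ) ≠ 0 := mod_cast hn
      rw [neg_add, cpow_add _ _ hn', ofReal_mul, ofReal_cpow (by positivity), ← mul_assoc]
      congr 2
      · simp
      · rw [cpow_def_of_ne_zero hn', natCast_log]
        congr 1
        ring
  have hphase (c t : ℝ) : ‖cexp (2 * π * t * c * I)‖ = 1 := by
    rw [← norm_exp_ofReal_mul_I (2 * π * t * c)]
    push_cast
    rfl
  have hmeas (c : ℝ) : AEStronglyMeasurable (fun t : ℝ ↦ cexp (2 * π * t * c * I)) :=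
    (by fun_prop : Continuous fun t : ℝ ↦ cexp (2 * π * t * c * I)).aestronglyMeasurable
  have h_int (c : ℝ) : Integrable fun t : ℝ ↦ cexp (2 * π * t * c * I) * φ t :=
    hφ.bdd_mul (c := 1) (hmeas c) (.of_forall fun t ↦ (hphase c t).le)
  have hF (n : ℕ) (t : ℝ) :
      cexp (2 * π * t * y * I) * φ t * LSeries.term ↗Λ (σ + 2 * π * t * I) n =
      ((Λ n * (n : ℝ) ^ (-σ) : ℝ) : ℂ) * (cexp (2 * π * t * (y - Real.log n : ℝ) * I) * φ t) := by
    rw [hterm, show (2 * π * t * (y - Real.log n : ℝ) * I : ℂ) =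
      2 * π * t * y * I + -(2 * π * t * Real.log n * I) by push_cast; ring, Complex.exp_add]
    ring
  have hsum : Summable fun n : ℕ ↦ Λ n * (n : ℝ) ^ (-σ) := by
    have := (ArithmeticFunction.LSeriesSummable_vonMangoldt
      (s := (σ : ℂ)) (by simpa using hσ)).norm
    refine this.congr fun n ↦ ?_
    have h := hterm n 0
    simp only [ofReal_zero, mul_zero, zero_mul, add_zero, neg_zero, Complex.exp_zero,
      mul_one] at h
    rw [h, norm_real, Real.norm_of_nonneg]
    exact mul_nonneg ArithmeticFunction.vonMangoldt_nonneg (by positivity)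
  have key := hasSum_integral_of_summable_integral_norm (μ := volume)
    (F := fun (n : ℕ) (t : ℝ) ↦ ((Λ n * (n : ℝ) ^ (-σ) : ℝ) : ℂ) *
      (cexp (2 * π * t * (y - Real.log n : ℝ) * I) * φ t))
    (fun n ↦ (h_int _).const_mul _) (by
      simp_rw [norm_mul, hphase, one_mul, integral_const_mul]
      exact (hsum.norm.congr fun n ↦ (norm_real _).symm).mul_right _)
  convert! key using 1
  · ext n
    rw [integral_const_mul, Real.fourier_real_eq_integral_exp_smul]
    congr! 5 with t
    push_cast
    ring
  · simp_rw [← hF, LSeries, tsum_mul_left]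

lemma integral_mul_one_div_eq_integral_fourier (hφ : Integrable φ) {σ : ℝ} (hσ : 1 < σ) (y : ℝ) :
    ∫ t : ℝ, cexp (2 * π * t * y * I) * φ t * (1 / (σ + 2 * π * t * I - 1)) =
      ∫ v in Set.Ioi (0 : ℝ), (Real.exp (-(σ - 1) * v) : ℂ) * 𝓕 φ (v - y) := by
  have h_int : Integrable (Function.uncurry fun t v : ℝ ↦
      cexp ((2 * π * t * (y - v) : ℝ) * I) * (φ t * (Real.exp (-(σ - 1) * v) : ℂ)))
      (volume.prod (volume.restrict (Set.Ioi 0))) := by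
    refine Integrable.bdd_mul (c := 1)
      (f := fun p : ℝ × ℝ ↦ cexp ((2 * π * p.1 * (y - p.2) : ℝ) * I))
      (g := fun p : ℝ × ℝ ↦ φ p.1 * (Real.exp (-(σ - 1) * p.2) : ℂ))
      (hφ.mul_prod (g := fun v : ℝ ↦ (Real.exp (-(σ - 1) * v) : ℂ)) ?_)
      (Continuous.aestronglyMeasurable (by fun_prop))
      (.of_forall fun p ↦ (norm_exp_ofReal_mul_I _).le)
    exact (integrableOn_exp_mul_Ioi (by linarith) 0).ofReal
  have hswap := integral_integral_swap h_int
  convert! hswap using 1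
  · refine integral_congr_ae (.of_forall fun t ↦ ?_)
    have h1 (v : ℝ) : cexp ((2 * π * t * (y - v) : ℝ) * I) *
        (φ t * (Real.exp (-(σ - 1) * v) : ℂ)) =
        cexp (2 * π * t * y * I) * φ t * cexp (-(σ + 2 * π * t * I - 1) * v) := by
      rw [ofReal_exp, mul_left_comm, mul_comm (cexp (2 * π * t * y * I)), mul_assoc (φ t),
        ← Complex.exp_add, ← Complex.exp_add]
      congr 2
      push_cast
      ring
    simp_rw [h1]
    rw [integral_const_mul, integral_exp_mul_complex_Ioi (by simp; linarith)]
    rw [ofReal_zero, mul_zero, Complex.exp_zero, neg_div_neg_eq]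
  · refine integral_congr_ae (.of_forall fun v ↦ ?_)
    simp only [Real.fourier_real_eq_integral_exp_smul]
    rw [← integral_const_mul]
    congr 1 with t
    rw [smul_eq_mul, show -2 * π * t * (v - y) = 2 * π * t * (y - v) by ring]
    ring

lemma re_integral_add_re_integral_le_sum (hφ : Continuous φ) (hsupp : HasCompactSupport φ)
    {G : ℂ → ℂ} (hG : ContinuousOn G {s | 1 ≤ s.re})
    (hLG : ∀ s : ℂ, 1 < s.re → LSeries ↗Λ s = G s + 1 / (s - 1))
    {y : ℝ} {s : Finset ℕ} (hs : ∀ n ∉ s, 1 ≤ n → (𝓕 φ (Real.log n - y)).re ≤ 0)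
    {σ : ℝ} (hσ : 1 < σ) :
    (∫ t : ℝ, cexp (2 * π * t * y * I) * φ t * G (σ + 2 * π * t * I)).re +
      (∫ v in Set.Ioi (0 : ℝ), (Real.exp (-(σ - 1) * v) : ℂ) * 𝓕 φ (v - y)).re ≤
      (∫ t, ‖φ t‖) * ∑ n ∈ s, Λ n / n := by
  have hφi : Integrable φ := hφ.integrable_of_hasCompactSupport hsupp
  have hre (t : ℝ) : (σ + 2 * π * t * I : ℂ).re = σ := by simp
  have hGc : Continuous fun t : ℝ ↦ G (σ + 2 * π * t * I) :=
    hG.comp_continuous (by fun_prop) fun t ↦ by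
      rw [Set.mem_ofPred_eq, hre]
      exact hσ.le
  have hne (t : ℝ) : (σ + 2 * π * t * I - 1 : ℂ) ≠ 0 := fun h ↦ by
    have := congrArg re h
    rw [sub_re, hre, one_re, zero_re] at this
    linarith
  have h_int (g : ℝ → ℂ) (hg : Continuous g) :
      Integrable fun t : ℝ ↦ cexp (2 * π * t * y * I) * φ t * g t :=
    Continuous.integrable_of_hasCompactSupport (by fun_prop) hsupp.mul_left.mul_right
  have hpole : Continuous fun t : ℝ ↦ (1 / (σ + 2 * π * t * I - 1) : ℂ) :=
    continuous_const.div (by fun_prop) hne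
  have hsum := hasSum_vonMangoldt_mul_fourier hφi hσ y
  rw [show (fun t : ℝ ↦ cexp (2 * π * t * y * I) * φ t * LSeries ↗Λ (σ + 2 * π * t * I)) =
      fun t : ℝ ↦ cexp (2 * π * t * y * I) * φ t * G (σ + 2 * π * t * I) +
        cexp (2 * π * t * y * I) * φ t * (1 / (σ + 2 * π * t * I - 1)) by
      ext t
      rw [hLG _ (by rwa [hre]), mul_add],
    integral_add (h_int _ hGc) (h_int _ hpole),
    integral_mul_one_div_eq_integral_fourier hφi hσ y] at hsum
  have hsum' := hasSum_re hsum
  rw [add_re] at hsum'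
  simp only [re_ofReal_mul] at hsum'
  have hw (n : ℕ) : 0 ≤ Λ n * (n : ℝ) ^ (-σ) :=
    mul_nonneg ArithmeticFunction.vonMangoldt_nonneg (by positivity)
  have h1 : ∀ n ∉ s, Λ n * (n : ℝ) ^ (-σ) * (𝓕 φ (Real.log n - y)).re ≤ 0 := fun n hn ↦ by
    rcases Nat.eq_zero_or_pos n with rfl | hn0
    · simp
    · exact mul_nonpos_of_nonneg_of_nonpos (hw n) (hs n hn hn0)
  have hle := sum_le_hasSum s (fun n hn ↦ neg_nonneg.2 (h1 n hn)) hsum'.neg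
  rw [Finset.sum_neg_distrib, neg_le_neg_iff] at hle
  refine hle.trans ?_
  rw [Finset.mul_sum]
  refine Finset.sum_le_sum fun n _ ↦ ?_
  have h2 : (𝓕 φ (Real.log n - y)).re ≤ ∫ t, ‖φ t‖ :=
    (re_le_norm _).trans (VectorFourier.norm_fourierIntegral_le_integral_norm _ _ _ _ _)
  rw [mul_comm]
  refine mul_le_mul h2 ?_ (hw n) (integral_nonneg fun _ ↦ norm_nonneg _)
  rcases Nat.eq_zero_or_pos n with rfl | hn0
  · simp
  · rw [div_eq_mul_inv, ← Real.rpow_neg_one]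
    exact mul_le_mul_of_nonneg_left
      (Real.rpow_le_rpow_of_exponent_le (by exact_mod_cast hn0) (by linarith))
      ArithmeticFunction.vonMangoldt_nonneg

lemma re_integral_add_re_integral_le_sum_one (hφ : Continuous φ) (hsupp : HasCompactSupport φ)
    (hF : Integrable (𝓕 φ)) {G : ℂ → ℂ} (hG : ContinuousOn G {s | 1 ≤ s.re})
    (hLG : ∀ s : ℂ, 1 < s.re → LSeries ↗Λ s = G s + 1 / (s - 1))
    {y : ℝ} {s : Finset ℕ} (hs : ∀ n ∉ s, 1 ≤ n → (𝓕 φ (Real.log n - y)).re ≤ 0) :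
    (𝓕 (fun t : ℝ ↦ φ t * G (1 + 2 * π * t * I)) (-y)).re +
      (∫ v in Set.Ioi (-y), 𝓕 φ v).re ≤ (∫ t, ‖φ t‖) * ∑ n ∈ s, Λ n / n := by
  have hcont : ContinuousOn
      (fun σ : ℝ ↦ ∫ t : ℝ, cexp (2 * π * t * y * I) * φ t * G (σ + 2 * π * t * I))
      (Set.Ici 1) := by
    refine continuousOn_integral_of_compact_support hsupp ?_ fun σ t _ ht ↦ ?_
    · refine ContinuousOn.mul (by fun_prop) (hG.comp (by fun_prop) ?_)
      rintro ⟨σ, t⟩ ⟨hσ, -⟩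
      simpa using hσ
    · simp [image_eq_zero_of_notMem_tsupport ht]
  have h1 := ((hcont 1 Set.self_mem_Ici).mono_left
    (nhdsWithin_mono _ Set.Ioi_subset_Ici_self) : Tendsto _ (𝓝[>] (1 : ℝ)) _)
  have h2 : Tendsto (fun σ : ℝ ↦ ∫ v in Set.Ioi (0 : ℝ),
      (Real.exp (-(σ - 1) * v) : ℂ) * 𝓕 φ (v - y)) (𝓝[>] 1)
      (𝓝 (∫ v in Set.Ioi (0 : ℝ), 𝓕 φ (v - y))) := by
    have hFy : Integrable (fun v ↦ 𝓕 φ (v - y)) := hF.comp_sub_right y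
    refine tendsto_integral_filter_of_dominated_convergence (fun v ↦ ‖𝓕 φ (v - y)‖)
      (.of_forall fun σ ↦ ?_) ?_ hFy.norm.integrableOn (.of_forall fun v ↦ ?_)
    · exact (Continuous.aestronglyMeasurable (by fun_prop)).mul hFy.integrableOn.1
    · filter_upwards [self_mem_nhdsWithin] with σ hσ
      filter_upwards [ae_restrict_mem measurableSet_Ioi] with v hv
      rw [norm_mul, norm_real, Real.norm_of_nonneg (Real.exp_pos _).le]
      refine mul_le_of_le_one_left (norm_nonneg _) (Real.exp_le_one_iff.2 ?_)
      have : 0 < (σ - 1) * v := mul_pos (sub_pos.2 hσ) hv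
      linarith
    · have : Continuous fun σ : ℝ ↦ (Real.exp (-(σ - 1) * v) : ℂ) * 𝓕 φ (v - y) := by fun_prop
      simpa using (this.tendsto 1).mono_left nhdsWithin_le_nhds
  have h3 := le_of_tendsto (((continuous_re.tendsto _).comp h1).add
      ((continuous_re.tendsto _).comp h2)) <| by
    filter_upwards [self_mem_nhdsWithin] with σ hσ
    exact re_integral_add_re_integral_le_sum hφ hsupp hG hLG hs hσ
  convert! h3 using 3
  · rw [Real.fourier_real_eq_integral_exp_smul]
    congr 1 with t
    rw [smul_eq_mul, ← mul_assoc, ofReal_one,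
      show (↑(-2 * π * t * -y) * I : ℂ) = 2 * π * t * y * I by push_cast; ring]
  · have h := (measurePreserving_sub_right volume y).setIntegral_preimage_emb
      (measurableEmbedding_subRight y) (𝓕 φ) (Set.Ioi (-y))
    rw [← h, Set.preimage_sub_const_Ioi, neg_add_cancel]

lemma eventually_le_sum_vonMangoldt_div (hφ : Continuous φ) (hsupp : HasCompactSupport φ)
    (hF : Integrable (𝓕 φ)) (hφ0 : 0 < (φ 0).re) {s : ℝ → Finset ℕ}
    (hs : ∀ y, ∀ n ∉ s y, 1 ≤ n → (𝓕 φ (Real.log n - y)).re ≤ 0) :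
    ∃ c > 0, ∀ᶠ y in atTop, c ≤ ∑ n ∈ s y, Λ n / n := by
  obtain ⟨G, hG, hLG⟩ := exists_continuousOn_LSeries_vonMangoldt_eq
  have hφi : Integrable φ := hφ.integrable_of_hasCompactSupport hsupp
  have hneg : Tendsto (fun y : ℝ ↦ -y) atTop atBot := tendsto_neg_atTop_atBot
  have h1 := (Real.zero_at_infty_fourier fun t : ℝ ↦ φ t * G (1 + 2 * π * t * I)).comp
    (hneg.mono_right atBot_le_cocompact)
  have h2 : Tendsto (fun y : ℝ ↦ ∫ v in Set.Ioi (-y), 𝓕 φ v) atTop (𝓝 (φ 0)) := by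
    have h := congrFun (hφ.fourierInv_fourier_eq hφi hF) 0
    rw [Real.fourierInv_eq'] at h
    simp only [inner_zero_right, mul_zero, ofReal_zero, zero_mul, Complex.exp_zero,
      one_smul] at h
    rw [← h]
    exact (aecover_Ioi hneg).integral_tendsto_of_countably_generated hF
  have h3 := ((continuous_re.tendsto _).comp h1).add ((continuous_re.tendsto _).comp h2)
  rw [zero_re, zero_add] at h3
  have hM : 0 ≤ ∫ t, ‖φ t‖ := integral_nonneg fun _ ↦ norm_nonneg _
  refine ⟨(φ 0).re / 2 / ((∫ t, ‖φ t‖) + 1), by positivity, ?_⟩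
  filter_upwards [h3.eventually (eventually_ge_nhds (half_lt_self hφ0))] with y hy
  rw [div_le_iff₀ (by positivity)]
  have hS : 0 ≤ ∑ n ∈ s y, Λ n / n := Finset.sum_nonneg fun n _ ↦
    div_nonneg ArithmeticFunction.vonMangoldt_nonneg (by positivity)
  have := hy.trans (re_integral_add_re_integral_le_sum_one hφ hsupp hF hG hLG (hs y))
  linarith

lemma sum_vonMangoldt_div_le {s : Finset ℕ} {a x : ℝ} (ha : 0 < a) (hx : 1 ≤ x)
    (hs : ∀ n ∈ s, 1 ≤ n → ¬ n.Prime ∧ a ≤ n ∧ n ≤ x) :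
    ∑ n ∈ s, Λ n / n ≤ 2 * √x * Real.log x / a := by
  have hx0 : 0 ≤ x := by linarith
  grw [← Chebyshev.psi_sub_theta_le hx, Chebyshev.psi_sub_theta_eq_sum_not_prime, Finset.sum_div]
  have hnn (n : ℕ) : 0 ≤ Λ n := ArithmeticFunction.vonMangoldt_nonneg
  calc ∑ n ∈ s, Λ n / n = ∑ n ∈ s with 1 ≤ n, Λ n / n := by
        rw [Finset.sum_filter_of_ne]
        intro n _ hn
        by_contra! h
        simp [Nat.lt_one_iff.1 h] at hn
    _ ≤ ∑ n ∈ s with 1 ≤ n, Λ n / a := by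
        refine Finset.sum_le_sum fun n hn ↦ ?_
        rw [Finset.mem_filter] at hn
        exact div_le_div_of_nonneg_left (hnn n) ha (hs n hn.1 hn.2).2.1
    _ ≤ _ := by
        refine Finset.sum_le_sum_of_subset_of_nonneg (fun n hn ↦ ?_)
          fun n _ _ ↦ div_nonneg (hnn n) ha.le
        rw [Finset.mem_filter] at hn
        obtain ⟨h1, -, h2⟩ := hs n hn.1 hn.2
        exact Finset.mem_filter.2 ⟨Finset.mem_Ioc.2 ⟨hn.2, Nat.le_floor h2⟩, h1⟩

lemma eventually_exists_prime_abs_log_sub_lt {η : ℝ} (hη : 0 < η) :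
    ∀ᶠ y : ℝ in atTop, ∃ q : ℕ, q.Prime ∧ |Real.log q - y| < η := by
  obtain ⟨φ, hφ, hsupp, hF, hφ0, hneg⟩ := exists_fourier_nonpos_of_le_abs hη
  have hbounds {n : ℕ} {y : ℝ} (hn : 1 ≤ n) (h : |Real.log n - y| < η) :
      Real.exp (y - η) ≤ n ∧ n ≤ Real.exp (y + η) := by
    have hn' : (0 : ℝ) < n := by exact_mod_cast hn
    rw [abs_lt] at h
    exact ⟨(Real.le_log_iff_exp_le hn').1 (by linarith),
      (Real.log_le_iff_le_exp hn').1 (by linarith)⟩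
  obtain ⟨c, hc, hsum⟩ := eventually_le_sum_vonMangoldt_div hφ hsupp hF hφ0
    (s := fun y ↦ {n ∈ Finset.range (⌊Real.exp (y + η)⌋₊ + 1) | |Real.log n - y| < η})
    fun y n hn hn1 ↦ hneg _ <| by
      contrapose! hn
      exact Finset.mem_filter.2
        ⟨Finset.mem_range.2 (Nat.lt_succ_of_le (Nat.le_floor (hbounds hn1 hn).2)), hn⟩
  have hlim : Tendsto (fun y : ℝ ↦ 2 * √(Real.exp (y + η)) * Real.log (Real.exp (y + η)) /
      Real.exp (y - η)) atTop (𝓝 0) := by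
    have h1 := ((Real.tendsto_pow_mul_exp_neg_atTop_nhds_zero 1).comp
      ((tendsto_atTop_add_const_right atTop η tendsto_id).atTop_div_const
        (two_pos (α := ℝ)))).const_mul (4 * Real.exp (2 * η))
    rw [mul_zero] at h1
    refine h1.congr fun y ↦ ?_
    have h2 : Real.exp (y - η) =
        Real.exp ((y + η) / 2) * Real.exp ((y + η) / 2) / Real.exp (2 * η) := by
      rw [← Real.exp_add, ← Real.exp_sub]
      congr 1
      ring
    rw [← Real.exp_half, Real.log_exp, h2]
    simp only [Function.comp_apply, id, pow_one, Real.exp_neg]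
    field_simp
    ring
  filter_upwards [hsum, hlim.eventually (eventually_lt_nhds hc), eventually_ge_atTop 0]
    with y h1 h2 h3
  by_contra! h4
  refine (h1.trans (sum_vonMangoldt_div_le (Real.exp_pos (y - η))
    (Real.one_le_exp (by linarith : 0 ≤ y + η)) fun n hn hn1 ↦ ?_)).not_gt h2
  have hn2 := (Finset.mem_filter.1 hn).2
  exact ⟨fun hp ↦ (h4 n hp).not_gt hn2, hbounds hn1 hn2⟩

end

/-- For every `ε > 0` there exists `A₁ ∈ ℕ` such that every
interval `(A, A(1+ε))` with real `A > A₁` contains a prime. -/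
theorem stmt_2 (ε : ℝ) (hε : 0 < ε) :
    ∃ A₁ : ℕ, ∀ A : ℝ, (A₁ : ℝ) < A →
      ∃ q : ℕ, q.Prime ∧ A < (q : ℝ) ∧ (q : ℝ) < A * (1 + ε) := by
  have hη : 0 < Real.log (1 + ε) / 2 := half_pos (Real.log_pos (by linarith))
  obtain ⟨Y, hY⟩ := Filter.eventually_atTop.1 (eventually_exists_prime_abs_log_sub_lt hη)
  refine ⟨⌈Real.exp Y⌉₊, fun A hA ↦ ?_⟩
  have hA' : Real.exp Y < A := (Nat.le_ceil _).trans_lt hA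
  have hA0 : 0 < A := (Real.exp_pos Y).trans hA'
  have hYA : Y < Real.log A := (Real.lt_log_iff_exp_lt hA0).2 hA'
  obtain ⟨q, hq, hqA⟩ := hY (Real.log A + Real.log (1 + ε) / 2) (by linarith)
  have hq0 : (0 : ℝ) < q := by exact_mod_cast hq.pos
  rw [abs_lt] at hqA
  refine ⟨q, hq, (Real.log_lt_log_iff hA0 hq0).1 (by linarith),
    (Real.log_lt_log_iff hq0 (by positivity)).1 ?_⟩
  rw [Real.log_mul hA0.ne' (by positivity)]
  linarith
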